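/- arXiv:2512.24010 — 8 statements merged into one kernel-verified Lean document; each statement's English description precedes it below -/
import Mathlib

section
/- Let λ₁, λ₂, λ₃, μ₁, μ₂, μ₃ : Fin 2 → ℂ and set pᵢ = −(λᵢ⊗μᵢ) for i = 1, 2, 3. Then: (i) if ⟨μ₁ μ₃⟩ ≠ 0, the matrix ℓ = (⟨μ₂ μ₃⟩/⟨μ₁ μ₃⟩) · (λ₂⊗μ₁) satisfies det ℓ = det(ℓ + p₂) = det(ℓ + p₂ + p₃) = det(ℓ − p₁) = 0; and (ii) if ⟨λ₁ λ₃⟩ ≠ 0, the matrix ℓ' = (⟨λ₂ λ₃⟩/⟨λ₁ λ₃⟩) · (λ₁⊗μ₂) satisfies det ℓ' = det(ℓ' + p₂) = det(ℓ' + p₂ + p₃) = det(ℓ' − p₁) = 0. -/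
/-- The spinor bracket `⟨u v⟩ = u 0 * v 1 - u 1 * v 0`. -/
def bracket (u v : Fin 2 → ℂ) : ℂ := u 0 * v 1 - u 1 * v 0

/-- The outer product `(u⊗w) i j = u i * w j` as a `2 × 2` complex matrix. -/
def outer (u w : Fin 2 → ℂ) : Matrix (Fin 2) (Fin 2) ℂ :=
  Matrix.of fun i j => u i * w j

/-- If `c ⟨x z⟩ = ⟨y z⟩`, then `c (u⊗x) - u⊗y - v⊗z` is singular. -/
lemma det_smul_outer_sub_sub_left (u v : Fin 2 → ℂ) {x y z : Fin 2 → ℂ} {c : ℂ}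
    (hc : c * bracket x z = bracket y z) :
    (c • outer u x + -(outer u y) + -(outer v z)).det = 0 := by
  simp only [bracket] at hc
  simp only [Matrix.det_fin_two, outer, Matrix.add_apply, Matrix.neg_apply, Matrix.smul_apply,
    Matrix.of_apply, smul_eq_mul]
  linear_combination -(u 0 * v 1 - u 1 * v 0) * hc

/-- If `c ⟨x z⟩ = ⟨y z⟩`, then `c (x⊗u) - y⊗u - z⊗v` is singular. -/
lemma det_smul_outer_sub_sub_right (u v : Fin 2 → ℂ) {x y z : Fin 2 → ℂ} {c : ℂ}
    (hc : c * bracket x z = bracket y z) :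
    (c • outer x u + -(outer y u) + -(outer z v)).det = 0 := by
  simp only [bracket] at hc
  simp only [Matrix.det_fin_two, outer, Matrix.add_apply, Matrix.neg_apply, Matrix.smul_apply,
    Matrix.of_apply, smul_eq_mul]
  linear_combination -(u 0 * v 1 - u 1 * v 0) * hc

/-- The two maximal-cut solutions of the massless one-loop box
in spinor-helicity variables: with `pᵢ = -(λᵢ⊗μᵢ)`,
(i) if `⟨μ₁ μ₃⟩ ≠ 0` then `ℓ = (⟨μ₂ μ₃⟩/⟨μ₁ μ₃⟩) • (λ₂⊗μ₁)` puts all four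
propagators on shell, and (ii) if `⟨λ₁ λ₃⟩ ≠ 0` then
`ℓ' = (⟨λ₂ λ₃⟩/⟨λ₁ λ₃⟩) • (λ₁⊗μ₂)` does as well. -/
theorem massless_box_max_cut_solutions
    (lam₁ lam₂ lam₃ mu₁ mu₂ mu₃ : Fin 2 → ℂ)
    (p₁ p₂ p₃ : Matrix (Fin 2) (Fin 2) ℂ)
    (hp₁ : p₁ = -(outer lam₁ mu₁)) (hp₂ : p₂ = -(outer lam₂ mu₂))
    (hp₃ : p₃ = -(outer lam₃ mu₃)) :
    (bracket mu₁ mu₃ ≠ 0 →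
      ∀ ℓ : Matrix (Fin 2) (Fin 2) ℂ,
        ℓ = (bracket mu₂ mu₃ / bracket mu₁ mu₃) • outer lam₂ mu₁ →
        ℓ.det = 0 ∧ (ℓ + p₂).det = 0 ∧ (ℓ + p₂ + p₃).det = 0 ∧ (ℓ - p₁).det = 0) ∧
    (bracket lam₁ lam₃ ≠ 0 →
      ∀ ℓ' : Matrix (Fin 2) (Fin 2) ℂ,
        ℓ' = (bracket lam₂ lam₃ / bracket lam₁ lam₃) • outer lam₁ mu₂ →
        ℓ'.det = 0 ∧ (ℓ' + p₂).det = 0 ∧ (ℓ' + p₂ + p₃).det = 0 ∧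
          (ℓ' - p₁).det = 0) := by
  subst hp₁ hp₂ hp₃
  constructor
  · rintro h ℓ rfl
    have hc := div_mul_cancel₀ (bracket mu₂ mu₃) h
    generalize bracket mu₂ mu₃ / bracket mu₁ mu₃ = c at hc ⊢
    refine ⟨?_, ?_, det_smul_outer_sub_sub_left lam₂ lam₃ hc, ?_⟩ <;>
      simp [Matrix.det_fin_two, outer] <;> ring
  · rintro h ℓ' rfl
    have hc := div_mul_cancel₀ (bracket lam₂ lam₃) h
    generalize bracket lam₂ lam₃ / bracket lam₁ lam₃ = c at hc ⊢
    refine ⟨?_, ?_, det_smul_outer_sub_sub_right mu₂ mu₃ hc, ?_⟩ <;>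
      simp [Matrix.det_fin_two, outer] <;> ring
end

section
/- Let p₁, …, p₆ ∈ V satisfy p₁ + p₂ + p₃ + p₄ + p₅ + p₆ = 0, B(p₁, p₁) = B(p₂, p₂) = 0, and B(p₁ + p₂, p₁ + p₂) = 0. Define s₃₄ = B(p₃ + p₄, p₃ + p₄), s₅₆ = B(p₅ + p₆, p₅ + p₆), s₂₃₄ = B(p₂ + p₃ + p₄, p₂ + p₃ + p₄). Let α₁, α₂, α₄ ∈ ℝ satisfy α₁·s₂₃₄ + α₂·s₃₄ + α₄·s₅₆ = 0 and α₁ + α₂ + α₄ ≠ 0, and set ℓ = (α₁ + α₂ + α₄)⁻¹ · (α₄·p₁ − α₂·p₂). Then all four on-shell conditions hold, B(ℓ, ℓ) = B(ℓ + p₂, ℓ + p₂) = B(ℓ − p₁, ℓ − p₁) = B(ℓ + p₂ + p₃ + p₄, ℓ + p₂ + p₃ + p₄) = 0, and the Landau loop equation α₁·ℓ + α₂·(ℓ + p₂) + α₄·(ℓ − p₁) = 0 holds (i.e. the loop equation with α₃ = 0). -/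
/-- The `s₁₂ = 0` solution of the Landau equations for the
quadruple-cut two-mass hard box: with `ℓ = (α₁+α₂+α₄)⁻¹ • (α₄•p₁ - α₂•p₂)` and
`α₁·s₂₃₄ + α₂·s₃₄ + α₄·s₅₆ = 0`, all four on-shell conditions hold and the Landau
loop equation with `α₃ = 0` is satisfied. -/
theorem two_mass_hard_box_s12_solution
    {V : Type*} [AddCommGroup V] [Module ℝ V]
    (B : V →ₗ[ℝ] V →ₗ[ℝ] ℝ) (hB : ∀ x y : V, B x y = B y x)
    (p₁ p₂ p₃ p₄ p₅ p₆ : V) (hsum : p₁ + p₂ + p₃ + p₄ + p₅ + p₆ = 0)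
    (h1 : B p₁ p₁ = 0) (h2 : B p₂ p₂ = 0)
    (h12 : B (p₁ + p₂) (p₁ + p₂) = 0)
    (s₃₄ s₅₆ s₂₃₄ : ℝ)
    (hs34 : s₃₄ = B (p₃ + p₄) (p₃ + p₄))
    (hs56 : s₅₆ = B (p₅ + p₆) (p₅ + p₆))
    (hs234 : s₂₃₄ = B (p₂ + p₃ + p₄) (p₂ + p₃ + p₄))
    (α₁ α₂ α₄ : ℝ)
    (hα : α₁ * s₂₃₄ + α₂ * s₃₄ + α₄ * s₅₆ = 0)
    (hD : α₁ + α₂ + α₄ ≠ 0)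
    (ℓ : V) (hℓ : ℓ = (α₁ + α₂ + α₄)⁻¹ • (α₄ • p₁ - α₂ • p₂)) :
    B ℓ ℓ = 0 ∧ B (ℓ + p₂) (ℓ + p₂) = 0 ∧ B (ℓ - p₁) (ℓ - p₁) = 0 ∧
    B (ℓ + p₂ + p₃ + p₄) (ℓ + p₂ + p₃ + p₄) = 0 ∧
    α₁ • ℓ + α₂ • (ℓ + p₂) + α₄ • (ℓ - p₁) = 0 := by
  have h12' : B p₁ p₂ = 0 := by
    simp only [map_add, LinearMap.add_apply, h1, h2, hB p₂ p₁] at h12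
    linarith
  have h21 : B p₂ p₁ = 0 := (hB p₂ p₁).trans h12'
  have h56 : p₅ + p₆ = -(p₁ + p₂ + p₃ + p₄) := by
    rw [eq_neg_iff_add_eq_zero, ← hsum]
    abel
  have hc : (α₁ + α₂ + α₄) * (α₁ + α₂ + α₄)⁻¹ = 1 := mul_inv_cancel₀ hD
  generalize (α₁ + α₂ + α₄)⁻¹ = c at hc hℓ
  subst hℓ
  refine ⟨?_, ?_, ?_, ?_, ?_⟩
  · simp [h1, h2, h12', h21]
  · simp [h1, h2, h12', h21]
  · simp [h1, h2, h12', h21]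
  · rw [h56] at hs56
    simp only [map_add, map_sub, map_neg, map_smul, LinearMap.add_apply, LinearMap.sub_apply,
      LinearMap.neg_apply, LinearMap.smul_apply, smul_eq_mul, h1, h2, h12', h21,
      hB p₃ p₁, hB p₄ p₁, hB p₃ p₂, hB p₄ p₂, hB p₄ p₃] at hs34 hs56 hs234 ⊢
    subst hs34 hs56 hs234
    linear_combination c * hα - hc * (2 * B p₂ p₃ + 2 * B p₂ p₄ + B p₃ p₃ + 2 * B p₃ p₄ + B p₄ p₄)
  · linear_combination (norm := module) hc • (α₄ • p₁ - α₂ • p₂)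
end

section
/- Let λ₁, λ₂, λ₃, λ₄, μ₁, μ₂, μ₃, μ₄ : Fin 2 → ℂ, set pᵢ = −(λᵢ⊗μᵢ) for i = 1, 2, 3, 4, define s₂₃₄ := ⟨λ₂ λ₃⟩·⟨μ₂ μ₃⟩ + ⟨λ₂ λ₄⟩·⟨μ₂ μ₄⟩ + ⟨λ₃ λ₄⟩·⟨μ₃ μ₄⟩ and Δ := ⟨λ₃ λ₁⟩·⟨μ₂ μ₃⟩ + ⟨λ₄ λ₁⟩·⟨μ₂ μ₄⟩, and assume Δ ≠ 0. Then s₂₃₄ = det(p₂ + p₃ + p₄), and the matrix ℓ = −(s₂₃₄/Δ) · (λ₁⊗μ₂) satisfies det ℓ = det(ℓ + p₂) = det(ℓ − p₁) = det(ℓ + p₂ + p₃ + p₄) = 0. -/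
/-- For the two-mass hard box in spinor-helicity variables, with
`pᵢ = -(λᵢ⊗μᵢ)`, `s₂₃₄ = ⟨λ₂λ₃⟩⟨μ₂μ₃⟩ + ⟨λ₂λ₄⟩⟨μ₂μ₄⟩ + ⟨λ₃λ₄⟩⟨μ₃μ₄⟩` and
`Δ = ⟨λ₃λ₁⟩⟨μ₂μ₃⟩ + ⟨λ₄λ₁⟩⟨μ₂μ₄⟩ ≠ 0`, one has `s₂₃₄ = det (p₂+p₃+p₄)` and the
loop momentum `ℓ = -(s₂₃₄/Δ) • (λ₁⊗μ₂)` puts all four propagators on shell. -/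
theorem two_mass_hard_box_max_cut
    (lam₁ lam₂ lam₃ lam₄ mu₁ mu₂ mu₃ mu₄ : Fin 2 → ℂ)
    (p₁ p₂ p₃ p₄ : Matrix (Fin 2) (Fin 2) ℂ)
    (hp₁ : p₁ = -(outer lam₁ mu₁)) (hp₂ : p₂ = -(outer lam₂ mu₂))
    (hp₃ : p₃ = -(outer lam₃ mu₃)) (hp₄ : p₄ = -(outer lam₄ mu₄))
    (s₂₃₄ Δ : ℂ)
    (hs : s₂₃₄ = bracket lam₂ lam₃ * bracket mu₂ mu₃ +
      bracket lam₂ lam₄ * bracket mu₂ mu₄ + bracket lam₃ lam₄ * bracket mu₃ mu₄)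
    (hΔ : Δ = bracket lam₃ lam₁ * bracket mu₂ mu₃ +
      bracket lam₄ lam₁ * bracket mu₂ mu₄)
    (hΔ0 : Δ ≠ 0)
    (ℓ : Matrix (Fin 2) (Fin 2) ℂ)
    (hℓ : ℓ = -((s₂₃₄ / Δ) • outer lam₁ mu₂)) :
    s₂₃₄ = (p₂ + p₃ + p₄).det ∧
    ℓ.det = 0 ∧ (ℓ + p₂).det = 0 ∧ (ℓ - p₁).det = 0 ∧
    (ℓ + p₂ + p₃ + p₄).det = 0 := by
  have hc : s₂₃₄ / Δ * Δ = s₂₃₄ := div_mul_cancel₀ _ hΔ0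
  generalize s₂₃₄ / Δ = c at hc hℓ
  rw [hs, hΔ] at hc
  subst hp₁ hp₂ hp₃ hp₄ hs hℓ
  simp only [bracket] at hc
  simp only [Matrix.det_fin_two, bracket, outer, Matrix.add_apply, Matrix.sub_apply,
    Matrix.neg_apply, Matrix.smul_apply, Matrix.of_apply, smul_eq_mul]
  refine ⟨by ring, by ring, by ring, by ring, ?_⟩
  linear_combination -hc
end

section
/- Let s₁₂, s₃₄, s₅₆, s₂₃₄ ∈ ℝ with s₁₂ ≠ 0 and s₂₃₄ ≠ 0. Then the only real solution (α₁, α₂, α₃, α₄) of the system ∂F/∂αᵢ = 0 for i = 1, 2, 3, 4 is the trivial one α₁ = α₂ = α₃ = α₄ = 0. In other words, away from the loci s₁₂ = 0 and s₂₃₄ = 0 the Feynman-parameter Landau equations of the quadruple-cut two-mass hard box admit no nontrivial solution. -/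
/-- The second Symanzik polynomial of the quadruple-cut two-mass hard box,
`F(α₁,α₂,α₃,α₄) = s₂₃₄ α₁ α₃ + s₃₄ α₂ α₃ + s₁₂ α₂ α₄ + s₅₆ α₃ α₄`
(variables indexed by `Fin 4`, `a i ↔ α_{i+1}`). -/
def boxF (s₁₂ s₃₄ s₅₆ s₂₃₄ : ℝ) (a : Fin 4 → ℝ) : ℝ :=
  s₂₃₄ * a 0 * a 2 + s₃₄ * a 1 * a 2 + s₁₂ * a 1 * a 3 + s₅₆ * a 2 * a 3

/-- The directional derivatives of `boxF`. -/
theorem fderiv_boxF_apply (s₁₂ s₃₄ s₅₆ s₂₃₄ : ℝ) (a v : Fin 4 → ℝ) :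
    fderiv ℝ (boxF s₁₂ s₃₄ s₅₆ s₂₃₄) a v =
      s₂₃₄ * a 2 * v 0 + (s₃₄ * a 2 + s₁₂ * a 3) * v 1 +
        (s₂₃₄ * a 0 + s₃₄ * a 1 + s₅₆ * a 3) * v 2 + (s₁₂ * a 1 + s₅₆ * a 2) * v 3 := by
  have hcoord (i : Fin 4) : HasFDerivAt (fun x : Fin 4 → ℝ => x i)
      (ContinuousLinearMap.proj (R := ℝ) (φ := fun _ : Fin 4 => ℝ) i) a :=
    hasFDerivAt_apply i a
  have hF : HasFDerivAt (boxF s₁₂ s₃₄ s₅₆ s₂₃₄) _ a :=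
    (((((hcoord 0).const_mul s₂₃₄).mul (hcoord 2)).add
      (((hcoord 1).const_mul s₃₄).mul (hcoord 2))).add
      (((hcoord 1).const_mul s₁₂).mul (hcoord 3))).add
      (((hcoord 2).const_mul s₅₆).mul (hcoord 3))
  rw [hF.fderiv]
  simp
  ring

/-- Away from the loci `s₁₂ = 0` and `s₂₃₄ = 0`, the
Feynman-parameter Landau equations `∂F/∂αᵢ = 0` (`i = 1,…,4`) of the
quadruple-cut two-mass hard box admit only the trivial solution `α = 0`. -/
theorem boxF_landau_no_nontrivial_solution (s₁₂ s₃₄ s₅₆ s₂₃₄ : ℝ)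
    (h12 : s₁₂ ≠ 0) (h234 : s₂₃₄ ≠ 0) :
    ∀ a : Fin 4 → ℝ, fderiv ℝ (boxF s₁₂ s₃₄ s₅₆ s₂₃₄) a = 0 → a = 0 := by
  intro a h
  have hv (i : Fin 4) := (fderiv_boxF_apply s₁₂ s₃₄ s₅₆ s₂₃₄ a (Pi.single i 1)).symm.trans
    (by rw [h]; rfl : _ = (0 : ℝ))
  have e0 := hv 0
  have e1 := hv 1
  have e2 := hv 2
  have e3 := hv 3
  simp [h234] at e0
  simp [e0, h12] at e1
  simp [e0, h12] at e3
  simp [e1, e3, h234] at e2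
  ext i
  fin_cases i <;> simp [e0, e1, e2, e3]
end

section
/- Let p₁, …, p₆ ∈ V satisfy p₁ + p₂ + p₃ + p₄ + p₅ + p₆ = 0, B(p₁, p₁) = B(p₂, p₂) = 0, and B(p₁ + p₂, p₁ + p₂) = 0. Define s₃₄ = B(p₃ + p₄, p₃ + p₄), s₅₆ = B(p₅ + p₆, p₅ + p₆), s₂₃₄ = B(p₂ + p₃ + p₄, p₂ + p₃ + p₄). Let α₁, α₂, α₄, α₅ ∈ ℝ satisfy α₁·(s₅₆·α₄ + s₂₃₄·α₅) + s₃₄·α₂·α₅ + s₅₆·α₄·(α₂ + α₅) = 0, and suppose D := (α₁ + α₂)·α₄ + (α₁ + α₂ + α₄)·α₅ ≠ 0. Set ℓ₁ = D⁻¹ · (α₄·α₅·p₁ − α₂·(α₄ + α₅)·p₂) and ℓ₅ = D⁻¹ · (α₄·((α₁ + α₂)·p₁ + α₂·p₂)). Then the five on-shell conditions hold: B(ℓ₁, ℓ₁) = B(ℓ₁ + p₂, ℓ₁ + p₂) = B(ℓ₁ + ℓ₅ + p₂ + p₃ + p₄, ℓ₁ + ℓ₅ + p₂ + p₃ + p₄)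 = B(ℓ₁ + ℓ₅ − p₁, ℓ₁ + ℓ₅ − p₁) = B(ℓ₅, ℓ₅) = 0, and the two Landau loop equations hold with α₃ = 0: α₁·ℓ₁ + α₂·(ℓ₁ + p₂) − α₅·ℓ₅ = 0 and α₅·ℓ₅ + α₄·(ℓ₁ + ℓ₅ − p₁) = 0. -/
/-- The `s₁₂ = 0` solution of the Landau equations for the fully-cut
two-mass hard acnode graph: the five internal edges are on shell and the two Landau
loop equations hold with `α₃ = 0`. -/
theorem acnode_s12_solution
    {V : Type*} [AddCommGroup V] [Module ℝ V]
    (B : V →ₗ[ℝ] V →ₗ[ℝ] ℝ) (hB : ∀ x y : V, B x y = B y x)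
    (p₁ p₂ p₃ p₄ p₅ p₆ : V) (hsum : p₁ + p₂ + p₃ + p₄ + p₅ + p₆ = 0)
    (h1 : B p₁ p₁ = 0) (h2 : B p₂ p₂ = 0)
    (h12 : B (p₁ + p₂) (p₁ + p₂) = 0)
    (s₃₄ s₅₆ s₂₃₄ : ℝ)
    (hs34 : s₃₄ = B (p₃ + p₄) (p₃ + p₄))
    (hs56 : s₅₆ = B (p₅ + p₆) (p₅ + p₆))
    (hs234 : s₂₃₄ = B (p₂ + p₃ + p₄) (p₂ + p₃ + p₄))
    (α₁ α₂ α₄ α₅ : ℝ)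
    (hα : α₁ * (s₅₆ * α₄ + s₂₃₄ * α₅) + s₃₄ * α₂ * α₅ + s₅₆ * α₄ * (α₂ + α₅) = 0)
    (D : ℝ) (hDdef : D = (α₁ + α₂) * α₄ + (α₁ + α₂ + α₄) * α₅) (hD : D ≠ 0)
    (ℓ₁ ℓ₅ : V)
    (hℓ₁ : ℓ₁ = D⁻¹ • ((α₄ * α₅) • p₁ - (α₂ * (α₄ + α₅)) • p₂))
    (hℓ₅ : ℓ₅ = D⁻¹ • (α₄ • ((α₁ + α₂) • p₁ + α₂ • p₂))) :
    B ℓ₁ ℓ₁ = 0 ∧ B (ℓ₁ + p₂) (ℓ₁ + p₂) = 0 ∧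
    B (ℓ₁ + ℓ₅ + p₂ + p₃ + p₄) (ℓ₁ + ℓ₅ + p₂ + p₃ + p₄) = 0 ∧
    B (ℓ₁ + ℓ₅ - p₁) (ℓ₁ + ℓ₅ - p₁) = 0 ∧ B ℓ₅ ℓ₅ = 0 ∧
    α₁ • ℓ₁ + α₂ • (ℓ₁ + p₂) - α₅ • ℓ₅ = 0 ∧
    α₅ • ℓ₅ + α₄ • (ℓ₁ + ℓ₅ - p₁) = 0 := by
  have h12' : B p₁ p₂ = 0 := by
    simp only [map_add, LinearMap.add_apply, hB p₂ p₁] at h12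
    linarith
  have h21 : B p₂ p₁ = 0 := by rw [hB, h12']
  have hnull : ∀ a b : ℝ, B (a • p₁ + b • p₂) (a • p₁ + b • p₂) = 0 := fun a b => by
    simp [h1, h2, h12', h21]
  have hnull_of_eq : ∀ (v : V) (a b : ℝ), v = a • p₁ + b • p₂ → B v v = 0 := by
    rintro _ a b rfl
    exact hnull a b
  refine ⟨?_, ?_, ?_, ?_, ?_, ?_, ?_⟩
  · refine hnull_of_eq _ (D⁻¹ * (α₄ * α₅)) (-(D⁻¹ * (α₂ * (α₄ + α₅)))) ?_
    rw [hℓ₁]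
    module
  · refine hnull_of_eq _ (D⁻¹ * (α₄ * α₅)) (1 - D⁻¹ * (α₂ * (α₄ + α₅))) ?_
    rw [hℓ₁]
    module
  · have hdecomp : ℓ₁ + ℓ₅ + p₂ + p₃ + p₄ =
        (D⁻¹ * (α₄ * (α₁ + α₂ + α₅))) • p₁ + (1 - D⁻¹ * (α₂ * α₅)) • p₂ + (p₃ + p₄) := by
      rw [hℓ₁, hℓ₅]
      module
    have hs56' : s₅₆ = B (p₁ + p₂ + (p₃ + p₄)) (p₁ + p₂ + (p₃ + p₄)) := by
      have hneg : p₅ + p₆ = -(p₁ + p₂ + (p₃ + p₄)) := by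
        rw [eq_neg_iff_add_eq_zero, ← hsum]
        abel
      rw [hs56, hneg]
      simp only [map_neg, LinearMap.neg_apply, neg_neg]
    rw [add_assoc p₂] at hs234
    rw [hdecomp]
    generalize p₃ + p₄ = q at *
    simp only [map_add, map_smul, LinearMap.add_apply, LinearMap.smul_apply, smul_eq_mul,
      h1, h2, h12', h21, hB q p₁, hB q p₂] at hs56' hs234 ⊢
    have hp₂q : B p₂ q = (s₂₃₄ - s₃₄) / 2 := by linarith
    have hp₁q : B p₁ q = (s₅₆ - s₂₃₄) / 2 := by linarith
    rw [hp₁q, hp₂q, ← hs34]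
    linear_combination D⁻¹ * hα - s₂₃₄ * inv_mul_cancel₀ hD + D⁻¹ * s₂₃₄ * hDdef
  · refine hnull_of_eq _ (D⁻¹ * (α₄ * (α₁ + α₂ + α₅)) - 1) (-(D⁻¹ * (α₂ * α₅))) ?_
    rw [hℓ₁, hℓ₅]
    module
  · refine hnull_of_eq _ (D⁻¹ * (α₄ * (α₁ + α₂))) (D⁻¹ * (α₄ * α₂)) ?_
    rw [hℓ₅]
    module
  · rw [hℓ₁, hℓ₅]
    match_scalars <;> field_simp <;> rw [hDdef] <;> ring
  · rw [hℓ₁, hℓ₅]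
    match_scalars <;> field_simp <;> rw [hDdef] <;> ring
end

section
/- Let s₁₂, s₃₄, s₅₆, s₂₃₄ ∈ ℝ with s₁₂ = 0, and let α₁, α₂, α₄, α₅, α₆ ∈ ℝ satisfy α₁·(α₂·α₅·s₃₄ + α₂·α₄·(s₃₄ + s₅₆ − s₂₃₄) + α₆·(α₅·s₂₃₄ + α₄·s₅₆)) + α₂·α₅·(α₄ + α₆)·s₃₄ + α₄·(α₂ + α₅)·α₆·s₅₆ = 0. Then at the point (α₁, α₂, α₃, α₄, α₅, α₆) = (α₁, α₂, 0, α₄, α₅, α₆), all six partial derivatives of F vanish: ∂F/∂αᵢ = 0 for i = 1, …, 6. -/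
/-- The second Symanzik polynomial of the fully-cut two-mass hard envelope
(crossed box) graph,
`F(α₁,…,α₆) = (s₅₆ − s₁₂ − s₂₃₄) α₁ α₂ α₃ α₄
  + ((s₂₃₄ α₁ α₃ + s₁₂ α₂ α₄) α₅ + s₅₆ α₃ α₄ (α₁ + α₂ + α₅)) α₆
  + s₃₄ α₂ α₃ (α₁ (α₄ + α₅) + α₅ (α₄ + α₆))`
(variables indexed by `Fin 6`, `a i ↔ α_{i+1}`). -/
def envelopeF (s₁₂ s₃₄ s₅₆ s₂₃₄ : ℝ) (a : Fin 6 → ℝ) : ℝ :=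
  (s₅₆ - s₁₂ - s₂₃₄) * a 0 * a 1 * a 2 * a 3 +
    ((s₂₃₄ * a 0 * a 2 + s₁₂ * a 1 * a 3) * a 4 +
      s₅₆ * a 2 * a 3 * (a 0 + a 1 + a 4)) * a 5 +
    s₃₄ * a 1 * a 2 * (a 0 * (a 3 + a 4) + a 4 * (a 3 + a 5))

/-- The derivative of a product vanishes at a common zero of its two factors. -/
theorem fderiv_mul_eq_zero_of_eq_zero {E : Type*} [NormedAddCommGroup E] [NormedSpace ℝ E]
    {f g : E → ℝ} {x : E} (hf : DifferentiableAt ℝ f x) (hg : DifferentiableAt ℝ g x)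
    (hfx : f x = 0) (hgx : g x = 0) : fderiv ℝ (fun y => f y * g y) x = 0 := by
  rw [fderiv_fun_mul hf hg, hfx, hgx, zero_smul, zero_smul, add_zero]

/-- On the locus `s₁₂ = 0`, with
`α₁ (α₂ α₅ s₃₄ + α₂ α₄ (s₃₄ + s₅₆ − s₂₃₄) + α₆ (α₅ s₂₃₄ + α₄ s₅₆))
 + α₂ α₅ (α₄ + α₆) s₃₄ + α₄ (α₂ + α₅) α₆ s₅₆ = 0`,
all six partial derivatives of the envelope `F` vanish at
`(α₁, α₂, 0, α₄, α₅, α₆)`. -/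
theorem envelopeF_landau_s12 (s₁₂ s₃₄ s₅₆ s₂₃₄ : ℝ) (hs : s₁₂ = 0)
    (α₁ α₂ α₄ α₅ α₆ : ℝ)
    (hα : α₁ * (α₂ * α₅ * s₃₄ + α₂ * α₄ * (s₃₄ + s₅₆ - s₂₃₄) +
        α₆ * (α₅ * s₂₃₄ + α₄ * s₅₆)) +
      α₂ * α₅ * (α₄ + α₆) * s₃₄ + α₄ * (α₂ + α₅) * α₆ * s₅₆ = 0) :
    fderiv ℝ (envelopeF s₁₂ s₃₄ s₅₆ s₂₃₄) ![α₁, α₂, 0, α₄, α₅, α₆] = 0 := by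
  subst hs
  have hF : envelopeF 0 s₃₄ s₅₆ s₂₃₄ = fun a => a 2 *
      ((s₅₆ - s₂₃₄) * a 0 * a 1 * a 3 + s₂₃₄ * a 0 * a 4 * a 5 +
        s₅₆ * a 3 * (a 0 + a 1 + a 4) * a 5 +
        s₃₄ * a 1 * (a 0 * (a 3 + a 4) + a 4 * (a 3 + a 5))) := by
    funext a
    simp only [envelopeF]
    ring
  rw [hF]
  refine fderiv_mul_eq_zero_of_eq_zero (by fun_prop) (by fun_prop) rfl ?_
  simp only [Matrix.cons_val]
  linear_combination hα
end

section
/- Let s₁₂, s₃₄, s₅₆, s₂₃₄ ∈ ℝ with s₂₃₄ = 0. Then for all α₁, α₃ ∈ ℝ, at the point (α₁, α₂, α₃, α₄, α₅, α₆) = (α₁, 0, α₃, 0, −α₁, −α₁), all six partial derivatives of F vanish: ∂F/∂αᵢ = 0 for i = 1, …, 6. -/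
/-- A product of two differentiable functions vanishing at a common point has zero derivative there. -/
theorem hasFDerivAt_mul_of_eq_zero {E : Type*} [NormedAddCommGroup E] [NormedSpace ℝ E]
    {u v : E → ℝ} {p : E} (hu : DifferentiableAt ℝ u p) (hv : DifferentiableAt ℝ v p)
    (hu₀ : u p = 0) (hv₀ : v p = 0) : HasFDerivAt (fun a => u a * v a) (0 : E →L[ℝ] ℝ) p := by
  simpa [hu₀, hv₀] using hu.hasFDerivAt.fun_mul hv.hasFDerivAt

/-- On the locus `s₂₃₄ = 0`, for all `α₁, α₃`, all six partial
derivatives of the envelope `F` vanish at `(α₁, 0, α₃, 0, −α₁, −α₁)`. -/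
theorem envelopeF_landau_s234_first (s₁₂ s₃₄ s₅₆ s₂₃₄ : ℝ) (hs : s₂₃₄ = 0) :
    ∀ α₁ α₃ : ℝ,
      fderiv ℝ (envelopeF s₁₂ s₃₄ s₅₆ s₂₃₄) ![α₁, 0, α₃, 0, -α₁, -α₁] = 0 := by
  intro α₁ α₃
  subst hs
  have h₁ := hasFDerivAt_mul_of_eq_zero (p := ![α₁, 0, α₃, 0, -α₁, -α₁])
    (u := fun a : Fin 6 → ℝ => a 1)
    (v := fun a : Fin 6 → ℝ => (s₅₆ - s₁₂) * a 0 * a 2 * a 3 + s₁₂ * a 3 * a 4 * a 5 +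
      s₃₄ * a 2 * (a 0 * (a 3 + a 4) + a 4 * (a 3 + a 5)))
    (by fun_prop) (by fun_prop) (by simp) (by simp)
  have h₂ := hasFDerivAt_mul_of_eq_zero (p := ![α₁, 0, α₃, 0, -α₁, -α₁])
    (u := fun a : Fin 6 → ℝ => a 3)
    (v := fun a : Fin 6 → ℝ => s₅₆ * a 2 * (a 0 + a 1 + a 4) * a 5)
    (by fun_prop) (by fun_prop) (by simp) (by simp)
  have h := h₁.fun_add h₂
  rw [add_zero] at h
  refine (h.congr_of_eventuallyEq (.of_forall fun a => ?_)).fderiv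
  simp only [envelopeF]
  ring
end

section
/- Let s₁₂, s₃₄, s₅₆, s₂₃₄ ∈ ℝ with s₂₃₄ = 0. Then for all α₁, α₅, α₆ ∈ ℝ, at the point (α₁, α₂, α₃, α₄, α₅, α₆) = (α₁, 0, 0, 0, α₅, α₆), all six partial derivatives of F vanish: ∂F/∂αᵢ = 0 for i = 1, …, 6. -/
/-- A function divisible by a product of two coordinates is stationary wherever both
coordinates vanish. -/
theorem hasFDerivAt_coord_mul_coord_mul {ι : Type*} [Fintype ι] {x : ι → ℝ} {i j : ι}
    (hi : x i = 0) (hj : x j = 0) {P : (ι → ℝ) → ℝ} (hP : DifferentiableAt ℝ P x) :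
    HasFDerivAt (fun a => a i * a j * P a) (0 : (ι → ℝ) →L[ℝ] ℝ) x := by
  refine (((hasFDerivAt_apply (𝕜 := ℝ) i x).fun_mul (hasFDerivAt_apply j x)).fun_mul
    hP.hasFDerivAt).congr_fderiv ?_
  simp [hi, hj]

/-- On the locus `s₂₃₄ = 0`, for all `α₁, α₅, α₆`, all six
partial derivatives of the envelope `F` vanish at `(α₁, 0, 0, 0, α₅, α₆)`. -/
theorem envelopeF_landau_s234_second (s₁₂ s₃₄ s₅₆ s₂₃₄ : ℝ) (hs : s₂₃₄ = 0) :
    ∀ α₁ α₅ α₆ : ℝ,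
      fderiv ℝ (envelopeF s₁₂ s₃₄ s₅₆ s₂₃₄) ![α₁, 0, 0, 0, α₅, α₆] = 0 := by
  subst hs
  intro α₁ α₅ α₆
  have h := ((hasFDerivAt_coord_mul_coord_mul (x := ![α₁, 0, 0, 0, α₅, α₆]) (i := 1) (j := 2)
    (P := fun a => (s₅₆ - s₁₂) * a 0 * a 3 + s₃₄ * (a 0 * (a 3 + a 4) + a 4 * (a 3 + a 5)))
    rfl rfl (by fun_prop)).fun_add
    (hasFDerivAt_coord_mul_coord_mul (i := 1) (j := 3) (P := fun a => s₁₂ * a 4 * a 5)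
      rfl rfl (by fun_prop))).fun_add
    (hasFDerivAt_coord_mul_coord_mul (i := 2) (j := 3)
      (P := fun a => s₅₆ * (a 0 + a 1 + a 4) * a 5) rfl rfl (by fun_prop))
  rw [add_zero, add_zero] at h
  refine (h.congr_of_eventuallyEq (.of_forall fun a => ?_)).fderiv
  simp only [envelopeF]
  ring
end
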